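/- Let μ ⊆ λ be partitions, let k be the number of parts of λ, and let N ≥ 1. In ℤ[x_1,…,x_N] one has Σ_ν f_{μν}^λ h_ν(x_1,…,x_N) = Σ_π χ_π x_1^{θ_1(π)}⋯x_N^{θ_N(π)}, where the left-hand sum runs over all partitions ν and the right-hand sum runs over all reverse plane partitions π of shape λ/μ with entries in {1,…,N}. -/

import Mathlib

open Finset MvPolynomial

/-- The distinct rearrangements of a `k`-tuple of naturals. -/
def rearr {k : ℕ} (a : Fin k → ℕ) : Finset (Fin k → ℕ) :=
  Finset.univ.image (fun w : Equiv.Perm (Fin k) => a ∘ w)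

/-- `conjP a j` is the `j`-th part of the conjugate partition of the tuple `a`. -/
def conjP {k : ℕ} (a : Fin k → ℕ) (j : ℕ) : ℕ :=
  (Finset.univ.filter fun i => j ≤ a i).card

/-- The weight factor `χ_{λ/μ} = Π_{i≥1} binom(λ'_i − μ'_{i+1}, μ'_i − μ'_{i+1})` if
`μ ⊆ λ`, and `0` otherwise.  (All factors with `j > λ_1 = sup λ` equal `1`.) -/
def chiSkew {k : ℕ} (lam mu : Fin k → ℕ) : ℕ :=
  if ∀ i, mu i ≤ lam i then
    ∏ j ∈ Finset.Icc 1 (Finset.univ.sup lam),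
      Nat.choose (conjP lam j - conjP mu (j + 1)) (conjP mu j - conjP mu (j + 1))
  else 0

/-- `f_{μν}^λ`: the number of pairs `(a,b)` with `a` a distinct rearrangement of `μ`,
`b` a distinct rearrangement of `ν` and `a + b = λ`. -/
def fCoeff {k : ℕ} (mu nu lam : Fin k → ℕ) : ℕ :=
  (((rearr mu) ×ˢ (rearr nu)).filter fun p => p.1 + p.2 = lam).card

def eC {k : ℕ} (a : Fin k → ℕ) (j : ℕ) : ℕ := (Finset.univ.filter fun i => j < a i).card

theorem eC_zero {k : ℕ} {a : Fin k → ℕ} {j : ℕ} (h : ∀ i, a i ≤ j) : eC a j = 0 := by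
  unfold eC
  rw [Finset.card_eq_zero, Finset.filter_eq_empty_iff]
  intro i _
  have := h i
  omega

open Classical in
theorem count_fiber {k : ℕ} (c m' : Fin k → ℕ) (m : ℕ → ℕ)
    (hm' : ∀ i, m' i ≤ c i - 1) (he : ∀ j, eC m' j = m (j + 1)) (h1 : m 1 ≤ m 0) :
    (((Fintype.piFinset fun i => Finset.range (c i + 1)).filter
      (fun a => ∀ j, eC a j = m j)).filter (fun a => (fun i => a i - 1) = m')).card =
      Nat.choose (eC c 0 - m 1) (m 0 - m 1) := by
  have hcard : ((Finset.univ.filter fun i => 0 < c i) \ (Finset.univ.filter fun i => 0 < m' i)).card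
      = eC c 0 - m 1 := by
    rw [Finset.card_sdiff_of_subset]
    · rw [← he 0]; rfl
    · intro i
      have := hm' i
      simp
      omega
  rw [← hcard, ← Finset.card_powersetCard]
  refine Finset.card_bij' (fun a _ => Finset.univ.filter fun i => a i = 1)
    (fun T _ => fun i => if i ∈ T then 1 else if m' i = 0 then 0 else m' i + 1) ?_ ?_ ?_ ?_
  · intro a ha
    simp only [Finset.mem_filter, Fintype.mem_piFinset, Finset.mem_range] at ha
    obtain ⟨⟨ha, hj⟩, rfl⟩ := ha
    rw [Finset.mem_powersetCard]
    constructor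
    · intro i
      have := ha i
      simp
      omega
    · rw [← hj 0, ← hj 1]
      unfold eC
      rw [← Finset.card_sdiff_of_subset]
      · congr 1
        ext i
        simp
        omega
      · intro i
        simp
        omega
  · intro T hT
    rw [Finset.mem_powersetCard] at hT
    obtain ⟨hT, hc⟩ := hT
    have hT' : ∀ i ∈ T, 0 < c i ∧ m' i = 0 := by
      intro i hi
      have := hT hi
      simpa using this
    simp only [Finset.mem_filter, Fintype.mem_piFinset, Finset.mem_range]
    refine ⟨⟨?_, ?_⟩, ?_⟩
    · intro i
      have := hm' i
      split_ifs with h h'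
      · have := hT' i h; omega
      · omega
      · omega
    · intro j
      cases j with
      | zero =>
        have : (Finset.univ.filter fun i => 0 < (if i ∈ T then 1 else if m' i = 0 then 0 else m' i + 1))
          = T ∪ Finset.univ.filter fun i => 0 < m' i := by
          ext i
          simp
          by_cases h : i ∈ T
          · simp [h]
          · simp [h]; split_ifs <;> omega
        unfold eC
        rw [this, Finset.card_union_of_disjoint, hc]
        · have := he 0
          unfold eC at this
          simp only [zero_add] at this
          omega
        · rw [Finset.disjoint_left]
          intro i hi
          have := hT' i hi
          simp [this]
      | succ j =>
        rw [← he j]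
        unfold eC
        congr 1
        ext i
        simp
        by_cases h : i ∈ T
        · simp [h, hT' i h]
        · simp [h]; split_ifs <;> omega
    · ext i
      by_cases h : i ∈ T
      · simp [h, hT' i h]
      · simp [h]; split_ifs <;> omega
  · intro a ha
    simp only [Finset.mem_filter, Fintype.mem_piFinset, Finset.mem_range] at ha
    obtain ⟨⟨ha, hj⟩, rfl⟩ := ha
    ext i
    simp
    split_ifs <;> omega
  · intro T hT
    rw [Finset.mem_powersetCard] at hT
    obtain ⟨hT, hc⟩ := hT
    have hT' : ∀ i ∈ T, 0 < c i ∧ m' i = 0 := by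
      intro i hi
      have := hT hi
      simpa using this
    ext i
    by_cases h : i ∈ T
    · simp [h]
    · by_cases h' : m' i = 0
      · simp [h, h']
      · simp [h, h']

open Classical in
theorem count_lem {k : ℕ} (M : ℕ) : ∀ (c : Fin k → ℕ) (m : ℕ → ℕ) (_ : ∀ i, c i ≤ M)
    (_ : ∀ j, m (j + 1) ≤ m j) (_ : ∀ j, m j ≤ eC c j),
    ((Fintype.piFinset fun i => Finset.range (c i + 1)).filter
      (fun a => ∀ j, eC a j = m j)).card =
      ∏ j ∈ Finset.range M, Nat.choose (eC c j - m (j + 1)) (m j - m (j + 1)) := by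
  induction M with
  | zero =>
    intro c m hc h1 h2
    have hm : ∀ j, m j = 0 := by
      intro j
      have := h2 j
      rw [eC_zero (fun i => (hc i).trans (Nat.zero_le _))] at this
      omega
    have : ((Fintype.piFinset fun i => Finset.range (c i + 1)).filter
      (fun a => ∀ j, eC a j = m j)) = {fun _ => 0} := by
      ext a
      simp only [Finset.mem_filter, Fintype.mem_piFinset, Finset.mem_range, Finset.mem_singleton]
      constructor
      · rintro ⟨h, _⟩
        ext i
        have := h i
        have := hc i
        omega
      · rintro rfl
        refine ⟨fun i => Nat.succ_pos _, fun j => ?_⟩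
        rw [hm, eC_zero]
        intro i; omega
    rw [this]
    simp
  | succ M ih =>
    intro c m hc h1 h2
    have hsh : ∀ (a : Fin k → ℕ) j, eC (fun i => a i - 1) j = eC a (j + 1) := by
      intro a j
      unfold eC
      congr 1
      ext i
      simp
      omega
    have ih' := ih (fun i => c i - 1) (fun j => m (j + 1)) (fun i => by have := hc i; simp; omega)
      (fun j => h1 _) (fun j => by rw [hsh]; exact h2 _)
    rw [Finset.prod_range_succ']
    simp only [hsh] at ih'
    rw [← ih']
    rw [Finset.card_eq_sum_card_fiberwise (f := fun a : Fin k → ℕ => fun i => a i - 1)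
      (t := (Fintype.piFinset fun i => Finset.range (c i - 1 + 1)).filter
      (fun a => ∀ j, eC a j = m (j + 1)))]
    · rw [Finset.sum_congr rfl (g := fun _ => Nat.choose (eC c 0 - m 1) (m 0 - m 1))]
      · simp
      · intro m' hm'
        simp only [Finset.mem_filter, Fintype.mem_piFinset, Finset.mem_range] at hm'
        exact count_fiber c m' m (fun i => by have := hm'.1 i; omega) hm'.2 (h1 0)
    · intro a ha
      simp only [Finset.coe_filter, Set.mem_ofPred_eq, Fintype.mem_piFinset, Finset.mem_range] at ha ⊢
      refine ⟨fun i => ?_, fun j => ?_⟩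
      · have := ha.1 i
        omega
      · rw [hsh, ha.2]

theorem conjP_succ {k : ℕ} (a : Fin k → ℕ) (j : ℕ) : conjP a (j + 1) = eC a j := rfl

theorem eC_comp {k : ℕ} (a : Fin k → ℕ) (w : Equiv.Perm (Fin k)) (j : ℕ) :
    eC (a ∘ w) j = eC a j := by
  unfold eC
  refine Finset.card_bij (fun i _ => w i) ?_ ?_ ?_
  · simp
  · intro a _ b _ h; exact w.injective h
  · intro b hb
    exact ⟨w.symm b, by simpa using hb, by simp⟩

theorem eC_rearr {k : ℕ} {a b : Fin k → ℕ} (h : b ∈ rearr a) (j : ℕ) : eC b j = eC a j := by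
  unfold rearr at h
  simp only [Finset.mem_image, Finset.mem_univ, true_and] at h
  obtain ⟨w, rfl⟩ := h
  exact eC_comp a w j

/-- decreasing sort -/
def sortD {k : ℕ} (c : Fin k → ℕ) : Fin k → ℕ :=
  c ∘ Tuple.sort (fun i => OrderDual.toDual (c i))

theorem sortD_antitone {k : ℕ} (c : Fin k → ℕ) : Antitone (sortD c) := by
  intro i j h
  exact Tuple.monotone_sort (fun i => OrderDual.toDual (c i)) h

theorem sortD_eq {k : ℕ} (c : Fin k → ℕ) (w : Equiv.Perm (Fin k)) (h : Antitone (c ∘ w)) :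
    sortD c = c ∘ w := by
  have := Tuple.unique_monotone (f := fun i => OrderDual.toDual (c i))
    (σ := Tuple.sort (fun i => OrderDual.toDual (c i))) (τ := w)
    (Tuple.monotone_sort _) (fun i j hij => h hij)
  exact this

theorem mem_rearr {k : ℕ} {a b : Fin k → ℕ} : b ∈ rearr a ↔ ∃ w : Equiv.Perm (Fin k), a ∘ w = b := by
  simp [rearr]

theorem mem_rearr_sortD {k : ℕ} (c : Fin k → ℕ) : c ∈ rearr (sortD c) := by
  rw [mem_rearr]
  refine ⟨(Tuple.sort (fun i => OrderDual.toDual (c i)))⁻¹, ?_⟩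
  ext i
  simp [sortD]

theorem sortD_eq_iff {k : ℕ} {ρ : Fin k → ℕ} (hρ : Antitone ρ) (c : Fin k → ℕ) :
    sortD c = ρ ↔ c ∈ rearr ρ := by
  constructor
  · rintro rfl
    exact mem_rearr_sortD c
  · rw [mem_rearr]
    rintro ⟨w, rfl⟩
    have : (ρ ∘ w) ∘ (w⁻¹ : Equiv.Perm (Fin k)) = ρ := by ext i; simp
    rw [sortD_eq _ w⁻¹ (by rw [this]; exact hρ), this]

theorem le_of_eC {k : ℕ} {a b : Fin k → ℕ} (ha : Antitone a) (hb : Antitone b)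
    (h : ∀ j, eC a j ≤ eC b j) (i : Fin k) : a i ≤ b i := by
  by_contra hlt
  push Not at hlt
  have h1 : (Finset.Iic i).card ≤ eC a (b i) := by
    apply Finset.card_le_card
    intro x hx
    simp only [Finset.mem_Iic] at hx
    have := ha hx
    simp
    omega
  have h2 : eC b (b i) ≤ (Finset.Iio i).card := by
    apply Finset.card_le_card
    intro x hx
    simp only [Finset.mem_filter, Finset.mem_univ, true_and] at hx
    simp only [Finset.mem_Iio]
    by_contra hc
    have := hb (not_lt.mp hc)
    omega
  have := h (b i)
  simp at h1 h2
  omega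

theorem rearr_iff {k : ℕ} (a b : Fin k → ℕ) : b ∈ rearr a ↔ ∀ j, eC b j = eC a j := by
  constructor
  · exact eC_rearr
  · intro h
    have hb := eC_rearr (mem_rearr_sortD b)
    have ha := eC_rearr (mem_rearr_sortD a)
    have : sortD b = sortD a := by
      ext i
      apply le_antisymm
      · exact le_of_eC (sortD_antitone _) (sortD_antitone _) (fun j => by rw [← ha, ← hb, h]) i
      · exact le_of_eC (sortD_antitone _) (sortD_antitone _) (fun j => by rw [← ha, ← hb, h]) i
    have h1 := mem_rearr_sortD b
    rw [this, mem_rearr] at h1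
    obtain ⟨w, hw⟩ := h1
    rw [mem_rearr]
    refine ⟨Tuple.sort (fun i => OrderDual.toDual (a i)) * w, ?_⟩
    rw [← hw]
    rfl

theorem eC_mono {k : ℕ} {a b : Fin k → ℕ} (h : ∀ i, a i ≤ b i) (j : ℕ) : eC a j ≤ eC b j := by
  apply Finset.card_le_card
  intro i
  have := h i
  simp
  omega

theorem cnt_chi {k : ℕ} {mu c ρ : Fin k → ℕ} (hmu : Antitone mu) (hρ : Antitone ρ)
    (hc : c ∈ rearr ρ) :
    ((rearr mu).filter (fun a => ∀ i, a i ≤ c i)).card = chiSkew ρ mu := by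
  have hec := eC_rearr hc
  classical
  unfold chiSkew
  split_ifs with h
  · have : ((rearr mu).filter (fun a => ∀ i, a i ≤ c i)) =
      ((Fintype.piFinset fun i => Finset.range (c i + 1)).filter
      (fun a => ∀ j, eC a j = eC mu j)) := by
      ext a
      simp only [Finset.mem_filter, rearr_iff, Fintype.mem_piFinset, Finset.mem_range,
        Nat.lt_succ_iff]
      tauto
    rw [this, count_lem (Finset.univ.sup ρ) c]
    · rw [← Finset.Ico_add_one_right_eq_Icc, Finset.prod_Ico_eq_prod_range]
      simp only [Nat.add_sub_cancel, add_comm 1, conjP_succ, hec]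
    · intro i
      rw [mem_rearr] at hc
      obtain ⟨w, rfl⟩ := hc
      exact Finset.le_sup (f := ρ) (Finset.mem_univ (w i))
    · intro j
      apply Finset.card_le_card
      intro i
      simp
      omega
    · intro j
      rw [hec]
      exact eC_mono h j
  · rw [Finset.card_eq_zero, Finset.filter_eq_empty_iff]
    intro a ha hle
    apply h
    apply le_of_eC hmu hρ
    intro j
    rw [← eC_rearr ha, ← hec]
    exact eC_mono hle j

/-- complete homogeneous evaluation -/
def hh {R : Type*} [CommRing R] (N : ℕ) (x : Fin N → R) (r : ℕ) : R :=
  ∑ p ∈ Finset.Nat.antidiagonalTuple N r, ∏ i, x i ^ p i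

theorem hsymm_eq_hh (N r : ℕ) :
    hsymm (Fin N) ℤ r = hh N (fun j => (X j : MvPolynomial (Fin N) ℤ)) r := by
  unfold hsymm hh
  refine Finset.sum_bij' (fun s _ => fun i => (s : Multiset (Fin N)).count i)
    (fun p hp => (Sym.equivNatSumOfFintype (Fin N) r).symm
      ⟨p, by simpa [Finset.Nat.mem_antidiagonalTuple] using hp⟩) ?_ ?_ ?_ ?_ ?_
  · intro s _
    rw [Finset.Nat.mem_antidiagonalTuple]
    exact ((Sym.equivNatSumOfFintype (Fin N) r) s).2
  · intro p hp
    simp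
  · intro s _
    rw [Equiv.symm_apply_eq]
    ext i
    simp
  · intro p hp
    have := (Sym.equivNatSumOfFintype (Fin N) r).apply_symm_apply
      ⟨p, by simpa [Finset.Nat.mem_antidiagonalTuple] using hp⟩
    exact congrArg Subtype.val this
  · intro s _
    rw [Finset.prod_multiset_map_count]
    exact Finset.prod_subset (Finset.subset_univ _) (fun i _ hi => by
      rw [Multiset.mem_toFinset] at hi
      have : Multiset.count i (s : Multiset (Fin N)) = 0 := Multiset.count_eq_zero_of_notMem hi
      change X i ^ Multiset.count i (s : Multiset (Fin N)) = 1
      rw [this, pow_zero])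

theorem hh_zero {R : Type*} [CommRing R] (x : Fin 0 → R) (r : ℕ) :
    hh 0 x r = if r = 0 then 1 else 0 := by
  unfold hh
  cases r with
  | zero => simp
  | succ r => simp

theorem hh_succ {R : Type*} [CommRing R] (N : ℕ) (x : Fin (N + 1) → R) (a l : ℕ) (h : a ≤ l) :
    hh (N + 1) x (l - a) = ∑ c ∈ Finset.Icc a l, x 0 ^ (c - a) * hh N (Fin.tail x) (l - c) := by
  unfold hh
  simp only [Finset.mul_sum]
  rw [Finset.sum_sigma']
  refine Finset.sum_bij' (fun p _ => (⟨p 0 + a, Fin.tail p⟩ : (_ : ℕ) × (Fin N → ℕ)))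
    (fun q _ => Fin.cons (q.1 - a) q.2) ?_ ?_ ?_ ?_ ?_
  · intro p hp
    rw [Finset.Nat.mem_antidiagonalTuple, Fin.sum_univ_succ] at hp
    rw [Finset.mem_sigma, Finset.Nat.mem_antidiagonalTuple, Finset.mem_Icc]
    simp only [Fin.tail]
    omega
  · rintro ⟨c, q⟩ hp
    rw [Finset.mem_sigma, Finset.Nat.mem_antidiagonalTuple, Finset.mem_Icc] at hp
    rw [Finset.Nat.mem_antidiagonalTuple, Fin.sum_univ_succ]
    simp only [Fin.cons_zero, Fin.cons_succ] at hp ⊢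
    omega
  · intro p hp
    simp
  · rintro ⟨c, q⟩ hp
    rw [Finset.mem_sigma, Finset.Nat.mem_antidiagonalTuple, Finset.mem_Icc] at hp
    simp only [Fin.cons_zero, Fin.tail_cons] at hp ⊢
    rw [Nat.sub_add_cancel hp.1.1]
  · intro p hp
    rw [Fin.prod_univ_succ]
    simp [Fin.tail]

theorem sum_rearr {k : ℕ} {a b : Fin k → ℕ} (h : b ∈ rearr a) {M : Type*} [AddCommMonoid M]
    (f : ℕ → M) : ∑ i, f (b i) = ∑ i, f (a i) := by
  rw [mem_rearr] at h
  obtain ⟨w, rfl⟩ := h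
  exact Equiv.sum_comp w (fun i => f (a i))

theorem prod_rearr {k : ℕ} {a b : Fin k → ℕ} (h : b ∈ rearr a) {M : Type*} [CommMonoid M]
    (f : ℕ → M) : ∏ i, f (b i) = ∏ i, f (a i) := by
  rw [mem_rearr] at h
  obtain ⟨w, rfl⟩ := h
  exact Equiv.prod_comp w (fun i => f (a i))

theorem regroup {k : ℕ} {M : Type*} [AddCommMonoid M] (B : ℕ) (F : (Fin k → ℕ) → M) :
    ∑ c ∈ Fintype.piFinset (fun _ : Fin k => Finset.range B), F c =
    ∑ ρ ∈ (Fintype.piFinset (fun _ : Fin k => Finset.range B)).filter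
      (fun nu => ∀ i j : Fin k, i ≤ j → nu j ≤ nu i), ∑ c ∈ rearr ρ, F c := by
  rw [← Finset.sum_fiberwise_of_maps_to (g := sortD)
    (t := (Fintype.piFinset (fun _ : Fin k => Finset.range B)).filter
      (fun nu => ∀ i j : Fin k, i ≤ j → nu j ≤ nu i))]
  · apply Finset.sum_congr rfl
    intro ρ hρ
    simp only [Finset.mem_filter, Fintype.mem_piFinset, Finset.mem_range] at hρ
    have hanti : Antitone ρ := fun i j h => hρ.2 i j h
    apply Finset.sum_congr _ (fun _ _ => rfl)
    ext c
    simp only [Finset.mem_filter, Fintype.mem_piFinset, Finset.mem_range, sortD_eq_iff hanti]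
    refine ⟨fun h => h.2, fun h => ⟨?_, h⟩⟩
    rw [mem_rearr] at h
    obtain ⟨w, rfl⟩ := h
    intro i
    exact hρ.1 _
  · intro c hc
    simp only [Finset.mem_filter, Fintype.mem_piFinset, Finset.mem_range] at hc ⊢
    exact ⟨fun i => hc _, fun i j h => sortD_antitone c h⟩

/-- chains -/
def chains (k N B : ℕ) (lam mu : Fin k → ℕ) : Finset (Fin (N + 1) → Fin k → ℕ) :=
  (Fintype.piFinset fun _ : Fin (N + 1) =>
          Fintype.piFinset fun _ : Fin k => Finset.range B).filter
        (fun π =>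
          π 0 = mu ∧ π (Fin.last N) = lam ∧
          (∀ s : Fin (N + 1), ∀ i j : Fin k, i ≤ j → π s j ≤ π s i) ∧
          (∀ s : Fin N, ∀ i, π s.castSucc i ≤ π s.succ i))

/-- right-hand side -/
def RR {R : Type*} [CommRing R] (k N B : ℕ) (x : Fin N → R) (lam mu : Fin k → ℕ) : R :=
  ∑ π ∈ chains k N B lam mu, (∏ s : Fin N, chiSkew (π s.succ) (π s.castSucc)) •
        ∏ j : Fin N, x j ^ (∑ i, π j.succ i - ∑ i, π j.castSucc i)

/-- left-hand side -/
def GG {R : Type*} [CommRing R] (k N : ℕ) (x : Fin N → R) (lam mu : Fin k → ℕ) : R :=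
  ∑ a ∈ (rearr mu).filter (fun a => ∀ i, a i ≤ lam i), ∏ i, hh N x (lam i - a i)

theorem chains_succ {k N B : ℕ} {lam mu : Fin k → ℕ} (hmu : Antitone mu) (hB : ∀ i, mu i < B)
    (π : Fin (N + 1) → Fin k → ℕ) :
    (Fin.cons mu π : Fin (N + 2) → Fin k → ℕ) ∈ chains k (N + 1) B lam mu ↔
      π ∈ chains k N B lam (π 0) ∧ ∀ i, mu i ≤ π 0 i := by
  unfold chains
  simp only [Finset.mem_filter, Fintype.mem_piFinset, Finset.mem_range]
  have e1 := Fin.forall_fin_succ (P := fun s : Fin (N + 2) =>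
    ∀ a : Fin k, (Fin.cons mu π : Fin (N + 2) → Fin k → ℕ) s a < B)
  have e2 := Fin.forall_fin_succ (P := fun s : Fin (N + 2) =>
    ∀ i j : Fin k, i ≤ j → (Fin.cons mu π : Fin (N + 2) → Fin k → ℕ) s j ≤
      (Fin.cons mu π : Fin (N + 2) → Fin k → ℕ) s i)
  have e3 := Fin.forall_fin_succ (P := fun s : Fin (N + 1) =>
    ∀ i, (Fin.cons mu π : Fin (N + 2) → Fin k → ℕ) s.castSucc i ≤
      (Fin.cons mu π : Fin (N + 2) → Fin k → ℕ) s.succ i)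
  rw [e1, e2, e3]
  simp only [Fin.cons_zero, Fin.cons_succ, ← Fin.succ_last, Fin.castSucc_zero, ← Fin.succ_castSucc]
  have : ∀ i j : Fin k, i ≤ j → mu j ≤ mu i := fun i j h => hmu h
  tauto

theorem RR_succ {R : Type*} [CommRing R] (k N B : ℕ) (x : Fin (N + 1) → R) (lam mu : Fin k → ℕ)
    (hmu : Antitone mu) (hB : ∀ i, mu i < B) :
    RR k (N + 1) B x lam mu =
    ∑ ρ ∈ (Fintype.piFinset (fun _ : Fin k => Finset.range B)).filter
      (fun nu => ∀ i j : Fin k, i ≤ j → nu j ≤ nu i),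
      chiSkew ρ mu • (x 0 ^ (∑ i, ρ i - ∑ i, mu i) * RR k N B (Fin.tail x) lam ρ) := by
  have h0 : ∀ ρ ∈ (Fintype.piFinset (fun _ : Fin k => Finset.range B)).filter
      (fun nu => ∀ i j : Fin k, i ≤ j → nu j ≤ nu i),
      chiSkew ρ mu • (x 0 ^ (∑ i, ρ i - ∑ i, mu i) * RR k N B (Fin.tail x) lam ρ) ≠ 0 →
      ∀ i, mu i ≤ ρ i := by
    intro ρ _ h
    by_contra hc
    apply h
    rw [chiSkew, if_neg hc, zero_smul]
  rw [← Finset.sum_filter_of_ne h0]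
  unfold RR
  simp only [Finset.mul_sum, Finset.smul_sum]
  rw [Finset.sum_sigma']
  symm
  have hch : ∀ q : (_ : Fin k → ℕ) × (Fin (N + 1) → Fin k → ℕ),
      q ∈ ((((Fintype.piFinset (fun _ : Fin k => Finset.range B)).filter
      (fun nu => ∀ i j : Fin k, i ≤ j → nu j ≤ nu i)).filter (fun ρ => ∀ i, mu i ≤ ρ i)).sigma
      (fun ρ => chains k N B lam ρ)) ↔ q.1 = q.2 0 ∧
        (Fin.cons mu q.2 : Fin (N + 2) → Fin k → ℕ) ∈ chains k (N + 1) B lam mu := by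
    rintro ⟨ρ, π⟩
    rw [chains_succ hmu hB]
    simp only [Finset.mem_sigma, Finset.mem_filter, Fintype.mem_piFinset, Finset.mem_range, chains]
    constructor
    · rintro ⟨⟨h1, h2⟩, h3, rfl, h4⟩
      exact ⟨rfl, ⟨h3, trivial, h4⟩, h2⟩
    · rintro ⟨rfl, ⟨h3, -, h4⟩, h2⟩
      exact ⟨⟨⟨fun i => h3 0 i, h4.2.1 0⟩, h2⟩, h3, rfl, h4⟩
  have hcons : ∀ π ∈ chains k (N + 1) B lam mu, Fin.cons mu (Fin.tail π) = π := by
    intro π hπ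
    have : π 0 = mu := by
      unfold chains at hπ
      exact (Finset.mem_filter.mp hπ).2.1
    rw [← this]
    exact Fin.cons_self_tail π
  refine Finset.sum_bij' (fun q _ => (Fin.cons mu q.2 : Fin (N + 2) → Fin k → ℕ))
    (fun π _ => ⟨π 1, Fin.tail π⟩) ?_ ?_ ?_ ?_ ?_
  · intro q hq
    exact ((hch q).mp hq).2
  · intro π hπ
    rw [hch]
    refine ⟨rfl, ?_⟩
    simp only
    rw [hcons π hπ]
    exact hπ
  · rintro ⟨ρ, π⟩ hq
    have := ((hch _).mp hq).1
    simp only at this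
    subst this
    rfl
  · intro π hπ
    exact hcons π hπ
  · rintro ⟨ρ, π⟩ hq
    have := ((hch _).mp hq).1
    simp only at this
    subst this
    rw [Fin.prod_univ_succ, Fin.prod_univ_succ]
    simp only [Fin.cons_zero, Fin.cons_succ, Fin.castSucc_zero, ← Fin.succ_castSucc, Fin.tail,
      mul_smul, mul_smul_comm]

theorem GG_succ {R : Type*} [CommRing R] (k N B : ℕ) (x : Fin (N + 1) → R) (lam mu : Fin k → ℕ)
    (hmu : Antitone mu) (hB : ∀ i, lam i < B) :
    GG k (N + 1) x lam mu =
    ∑ ρ ∈ (Fintype.piFinset (fun _ : Fin k => Finset.range B)).filter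
      (fun nu => ∀ i j : Fin k, i ≤ j → nu j ≤ nu i),
      chiSkew ρ mu • (x 0 ^ (∑ i, ρ i - ∑ i, mu i) * GG k N (Fin.tail x) lam ρ) := by
  have h1 : GG k (N + 1) x lam mu =
      ∑ c ∈ (Fintype.piFinset (fun _ : Fin k => Finset.range B)).filter (fun c => ∀ i, c i ≤ lam i),
       ∑ a ∈ (rearr mu).filter (fun a => ∀ i, a i ≤ c i),
        (x 0 ^ (∑ i, c i - ∑ i, mu i) * ∏ i, hh N (Fin.tail x) (lam i - c i)) := by
    rw [Finset.sum_comm' (t' := (rearr mu).filter (fun a => ∀ i, a i ≤ lam i))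
      (s' := fun a => Fintype.piFinset (fun i => Finset.Icc (a i) (lam i)))]
    · unfold GG
      apply Finset.sum_congr rfl
      intro a ha
      rw [Finset.mem_filter] at ha
      rw [Finset.prod_congr rfl (fun i _ => hh_succ N x (a i) (lam i) (ha.2 i)),
        Finset.prod_univ_sum]
      apply Finset.sum_congr rfl
      intro c hc
      simp only [Fintype.mem_piFinset, Finset.mem_Icc] at hc
      rw [Finset.prod_mul_distrib, Finset.prod_pow_eq_pow_sum,
        Finset.sum_tsub_distrib _ (fun i _ => (hc i).1), ← sum_rearr ha.1 (fun i => i)]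
    · intro c a
      simp only [Finset.mem_filter, Fintype.mem_piFinset, Finset.mem_Icc, Finset.mem_range]
      constructor
      · rintro ⟨⟨h1, h2⟩, h3, h4⟩
        exact ⟨fun i => ⟨h4 i, h2 i⟩, h3, fun i => (h4 i).trans (h2 i)⟩
      · rintro ⟨h1, h3, h4⟩
        exact ⟨⟨fun i => (h1 i).2.trans_lt (hB i), fun i => (h1 i).2⟩, h3, fun i => (h1 i).1⟩
  rw [h1, Finset.sum_filter, regroup]
  apply Finset.sum_congr rfl
  intro ρ hρ
  simp only [Finset.mem_filter] at hρ
  have hanti : Antitone ρ := fun i j h => hρ.2 i j h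
  rw [← Finset.sum_filter]
  unfold GG
  rw [Finset.mul_sum, Finset.smul_sum]
  apply Finset.sum_congr rfl
  intro c hc
  rw [Finset.mem_filter] at hc
  rw [Finset.sum_const, cnt_chi hmu hanti hc.1, sum_rearr hc.1 (fun i => i)]

theorem core {R : Type*} [CommRing R] (k B : ℕ) (lam : Fin k → ℕ) (hlam : Antitone lam)
    (hB : ∀ i, lam i < B) (N : ℕ) : ∀ (x : Fin N → R) (mu : Fin k → ℕ) (_ : Antitone mu)
    (_ : ∀ i, mu i < B), GG k N x lam mu = RR k N B x lam mu := by
  induction N with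
  | zero =>
    intro x mu hmu hmB
    have hG : ∀ a ∈ (rearr mu).filter (fun a => ∀ i, a i ≤ lam i),
        ∏ i, hh 0 x (lam i - a i) = if a = lam then 1 else 0 := by
      intro a ha
      rw [Finset.mem_filter] at ha
      simp only [hh_zero]
      split_ifs with h
      · subst h; simp
      · obtain ⟨i, hi⟩ := Function.ne_iff.mp h
        apply Finset.prod_eq_zero (Finset.mem_univ i)
        rw [if_neg]
        have := ha.2 i
        omega
    unfold GG
    rw [Finset.sum_congr rfl hG, Finset.sum_ite_eq']
    have hmem : lam ∈ (rearr mu).filter (fun a => ∀ i, a i ≤ lam i) ↔ mu = lam := by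
      rw [Finset.mem_filter, ← sortD_eq_iff hmu]
      have : sortD lam = lam := by
        rw [sortD_eq_iff hlam, mem_rearr]
        exact ⟨1, rfl⟩
      rw [this]
      constructor
      · rintro ⟨h, _⟩; exact h.symm
      · rintro rfl; exact ⟨rfl, fun i => le_rfl⟩
    simp only [hmem]
    unfold RR
    by_cases h : mu = lam
    · subst h
      have : chains k 0 B mu mu = {fun _ => mu} := by
        ext π
        simp only [chains, Finset.mem_filter, Fintype.mem_piFinset, Finset.mem_range,
          Finset.mem_singleton]
        constructor
        · rintro ⟨_, h, _⟩
          ext s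
          rw [Fin.fin_one_eq_zero s, h]
        · rintro rfl
          exact ⟨fun _ => hmB, rfl, rfl, fun _ i j h => hmu h, fun s => s.elim0⟩
      rw [this]
      simp
    · have : chains k 0 B lam mu = ∅ := by
        unfold chains
        rw [Finset.filter_eq_empty_iff]
        rintro π _ ⟨h1, h2, _⟩
        exact h (h1.symm.trans h2)
      rw [this]
      simp [h]
  | succ N ih =>
    intro x mu hmu hmB
    rw [GG_succ k N B x lam mu hmu hB, RR_succ k N B x lam mu hmu hmB]
    apply Finset.sum_congr rfl
    intro ρ hρ
    simp only [Finset.mem_filter, Fintype.mem_piFinset, Finset.mem_range] at hρ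
    rw [ih (Fin.tail x) ρ (fun i j h => hρ.2 i j h) hρ.1]

theorem lhs_eq {R : Type*} [CommRing R] (k : ℕ) (h : ℕ → R) (lam mu : Fin k → ℕ) :
    ∑ nu ∈ (Fintype.piFinset fun _ : Fin k => Finset.range (∑ i, lam i + 1)).filter
        (fun nu => ∀ i j : Fin k, i ≤ j → nu j ≤ nu i),
      fCoeff mu nu lam • ∏ i : Fin k, h (nu i) =
    ∑ a ∈ (rearr mu).filter (fun a => ∀ i, a i ≤ lam i), ∏ i, h (lam i - a i) := by
  have h1 : ∀ nu : Fin k → ℕ, fCoeff mu nu lam • ∏ i : Fin k, h (nu i) =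
      ∑ b ∈ rearr nu, ∑ a ∈ rearr mu, if a + b = lam then ∏ i, h (b i) else 0 := by
    intro nu
    unfold fCoeff
    rw [Finset.sum_comm, ← Finset.sum_product', ← Finset.sum_filter, ← Finset.sum_const]
    apply Finset.sum_congr rfl
    intro p hp
    rw [Finset.mem_filter, Finset.mem_product] at hp
    exact (prod_rearr hp.1.2 h).symm
  simp only [h1]
  rw [← regroup, Finset.sum_comm, Finset.sum_filter]
  apply Finset.sum_congr rfl
  intro a ha
  split_ifs with hle
  · rw [Finset.sum_eq_single (lam - a)]
    · rw [if_pos]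
      · rfl
      · ext i
        have := hle i
        simp
        omega
    · intro b _ hb
      rw [if_neg]
      rintro rfl
      apply hb
      ext i
      simp
    · intro hn
      exfalso
      apply hn
      simp only [Fintype.mem_piFinset, Finset.mem_range, Pi.sub_apply]
      intro i
      have := Finset.single_le_sum (f := lam) (fun _ _ => Nat.zero_le _) (Finset.mem_univ i)
      omega
  · apply Finset.sum_eq_zero
    intro b _
    rw [if_neg]
    rintro rfl
    apply hle
    intro i
    simp

/-- for partitions `μ ⊆ λ`, `λ` with `k` parts, one has in `ℤ[x_1,…,x_N]`
`Σ_ν f_{μν}^λ h_ν = Σ_π χ_π x^{θ(π)}`, where the left sum is over all partitions `ν`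
(finite: `f_{μν}^λ = 0` unless `ν` has at most `k` parts, each `≤ |λ|`), and the right
sum is over all reverse plane partitions `π` of shape `λ/μ` with entries in `{1,…,N}`,
encoded as chains `μ = λ⁽⁰⁾ ⊆ λ⁽¹⁾ ⊆ ⋯ ⊆ λ⁽ᴺ⁾ = λ` with weight
`θ_j(π) = |λ⁽ʲ⁾| − |λ⁽ʲ⁻¹⁾|` and weight factor `χ_π = Π_j χ_{λ⁽ʲ⁾/λ⁽ʲ⁻¹⁾}`. -/
theorem stmt_4 (k N : ℕ) (hN : 1 ≤ N) (lam mu : Fin k → ℕ) (hlam : Antitone lam)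
    (hlampos : ∀ i, 0 < lam i) (hmu : Antitone mu) (hsub : ∀ i, mu i ≤ lam i) :
    ∑ nu ∈ (Fintype.piFinset fun _ : Fin k => Finset.range (∑ i, lam i + 1)).filter
        (fun nu => ∀ i j : Fin k, i ≤ j → nu j ≤ nu i),
      fCoeff mu nu lam • ∏ i : Fin k, hsymm (Fin N) ℤ (nu i) =
    ∑ π ∈ (Fintype.piFinset fun _ : Fin (N + 1) =>
          Fintype.piFinset fun _ : Fin k => Finset.range (Finset.univ.sup lam + 1)).filter
        (fun π =>
          π 0 = mu ∧ π (Fin.last N) = lam ∧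
          (∀ s : Fin (N + 1), ∀ i j : Fin k, i ≤ j → π s j ≤ π s i) ∧
          (∀ s : Fin N, ∀ i, π s.castSucc i ≤ π s.succ i)),
      (∏ s : Fin N, chiSkew (π s.succ) (π s.castSucc)) •
        ∏ j : Fin N, (X j : MvPolynomial (Fin N) ℤ) ^ (∑ i, π j.succ i - ∑ i, π j.castSucc i) := by
  rw [lhs_eq k (fun r => hsymm (Fin N) ℤ r)]
  simp only [hsymm_eq_hh]
  have hB : ∀ i, lam i < Finset.univ.sup lam + 1 := fun i =>
    Nat.lt_succ_of_le (Finset.le_sup (f := lam) (Finset.mem_univ i))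
  exact core k (Finset.univ.sup lam + 1) lam hlam hB N (fun j => X j) mu hmu
    (fun i => (hsub i).trans_lt (hB i))
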